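/- arXiv:1803.08221 — 2 statements merged into one kernel-verified Lean document; each statement's English description precedes it below -/
import Mathlib

section
/- In the network model, assume n₁ > 0. Then Pr(E₀ | m₀=0) = (1−p)^(n−n₁) · Σ_{i=1}^{n₁} b_i · p^i · (1−p)^(n₁−i). That is, Σ_{S ⊆ V, L_j ∩ S = ∅ ∀ j∈B, L_i ∩ S ≠ ∅ ∀ i∈A} p^|S|(1−p)^(n−|S|) = (1−p)^(n−n₁) Σ_{i=1}^{n₁} b_i p^i (1−p)^(n₁−i). -/
/-- Theorem 3 of the paper: when `n₁ > 0`, the probability of the observation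
event `E₀` conditioned on source message `m₀ = 0` equals
`(1-p)^(n-n₁) · Σ_{i=1}^{n₁} b_i p^i (1-p)^(n₁-i)`,
where `b_i` counts the `i`-element subsets of the Type-1 vehicles `T₁` that
intersect every path delivering content 1. -/
theorem prob_event_given_source_zero_pos
    {V : Type*} [Fintype V] [DecidableEq V]
    (p : ℝ) (hp0 : 0 < p) (hp1 : p < 1)
    (k : ℕ) (L : Fin k → Finset V) (hL : ∀ i, (L i).Nonempty)
    (m : Fin k → Bool)
    (A B : Finset (Fin k))
    (hA : A = Finset.univ.filter (fun i => m i = true))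
    (hB : B = Finset.univ.filter (fun i => m i = false))
    (hAne : A.Nonempty) (hBne : B.Nonempty)
    (T₁ : Finset V) (hT₁ : T₁ = Finset.univ \ B.biUnion L)
    (n₁ : ℕ) (hn₁ : n₁ = T₁.card) (hn₁pos : 0 < n₁)
    (b : ℕ → ℕ)
    (hb : ∀ i, b i = (T₁.powerset.filter
      (fun S => S.card = i ∧ ∀ j ∈ A, (L j ∩ S).Nonempty)).card) :
    ∑ S ∈ (Finset.univ : Finset V).powerset.filter
        (fun S => (∀ j ∈ B, L j ∩ S = ∅) ∧ ∀ i ∈ A, (L i ∩ S).Nonempty),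
      p ^ S.card * (1 - p) ^ (Fintype.card V - S.card)
    = (1 - p) ^ (Fintype.card V - n₁) *
        ∑ i ∈ Finset.Icc 1 n₁, (b i : ℝ) * p ^ i * (1 - p) ^ (n₁ - i) := by
  have hfamily : (Finset.univ : Finset V).powerset.filter
      (fun S => (∀ j ∈ B, L j ∩ S = ∅) ∧ ∀ i ∈ A, (L i ∩ S).Nonempty)
      = T₁.powerset.filter (fun S => ∀ i ∈ A, (L i ∩ S).Nonempty) := by
    ext S
    have hsub : (∀ j ∈ B, L j ∩ S = ∅) ↔ S ⊆ T₁ := by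
      rw [hT₁, Finset.subset_sdiff, Finset.disjoint_biUnion_right]
      simp [← Finset.disjoint_iff_inter_eq_empty, disjoint_comm]
    simp [hsub]
  have hcard : ∀ S ∈ T₁.powerset.filter (fun S => ∀ i ∈ A, (L i ∩ S).Nonempty),
      S.card ∈ Finset.Icc 1 n₁ := by
    intro S hS
    rw [Finset.mem_filter, Finset.mem_powerset] at hS
    obtain ⟨i, hi⟩ := hAne
    rw [Finset.mem_Icc, hn₁]
    exact ⟨Finset.card_pos.2 ((hS.2 i hi).mono Finset.inter_subset_right),
      Finset.card_le_card hS.1⟩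
  have hn₁le : n₁ ≤ Fintype.card V := hn₁ ▸ Finset.card_le_univ T₁
  rw [hfamily, ← Finset.sum_fiberwise_of_maps_to hcard, Finset.mul_sum]
  refine Finset.sum_congr rfl fun i hi => ?_
  have hile : i ≤ n₁ := (Finset.mem_Icc.1 hi).2
  rw [Finset.filter_filter, hb i,
    Finset.filter_congr fun S _ => and_comm (b := S.card = i)]
  rw [Finset.sum_congr rfl (g := fun _ => p ^ i * (1 - p) ^ (Fintype.card V - i))
    (fun S hS => by rw [(Finset.mem_filter.1 hS).2.1]), Finset.sum_const, nsmul_eq_mul,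
    show Fintype.card V - i = (Fintype.card V - n₁) + (n₁ - i) by omega, pow_add]
  ring
end

section
/- Let n, n₀, n₁ be natural numbers with n₀ ≤ n and n₁ ≤ n, let a_1,…,a_{n₀} and b_1,…,b_{n₁} be nonnegative integers that are not all zero, and set r₀ = min{i : a_i > 0} and r₁ = min{i : b_i > 0}. Define f(p) = (1−p)^(n−n₀) Σ_{i=r₀}^{n₀} a_i p^i (1−p)^(n₀−i) and g(p) = (1−p)^(n−n₁) Σ_{i=r₁}^{n₁} b_i p^i (1−p)^(n₁−i). If r₀ < r₁, then there exists ε > 0 such that f(p) > g(p) for all p ∈ (0, ε); symmetrically, if r₀ > r₁, then there exists ε > 0 such that f(p) < g(p) for all p ∈ (0, ε). Hence for all sufficiently small p the heuristic decision rule, which decides 1 when r₀ < r₁ and 0 when r₀ > r₁, agrees with the maximum-likelihood decision comparing f(p) and g(p). -/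
/-- A binomial-type sum starting at index `r` factors as `p ^ r` times a continuous function whose
value at `0` is the leading coefficient. -/
lemma exists_continuous_factor (m N r : ℕ) (hr : r ≤ N) (a : ℕ → ℕ) :
    ∃ h : ℝ → ℝ, Continuous h ∧ h 0 = a r ∧ ∀ p : ℝ,
      (1 - p) ^ m * ∑ i ∈ Finset.Icc r N, (a i : ℝ) * p ^ i * (1 - p) ^ (N - i) = p ^ r * h p := by
  refine ⟨fun p => (1 - p) ^ m *
    ∑ i ∈ Finset.Icc r N, (a i : ℝ) * p ^ (i - r) * (1 - p) ^ (N - i), by fun_prop, ?_, fun p => ?_⟩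
  · simp only [sub_zero, one_pow, one_mul, mul_one]
    rw [Finset.sum_eq_single_of_mem r (Finset.mem_Icc.2 ⟨le_rfl, hr⟩)]
    · simp
    · intro i hi hne
      have hi' := (Finset.mem_Icc.1 hi).1
      rw [zero_pow (by omega), mul_zero]
  · rw [mul_left_comm, Finset.mul_sum _ _ (p ^ r)]
    congr 1
    refine Finset.sum_congr rfl fun i hi => ?_
    rw [← pow_mul_pow_sub p (Finset.mem_Icc.1 hi).1]
    ring

/-- Near `0` from the right, the function with the smaller order of vanishing and a positive leading
coefficient dominates. -/
lemma exists_pos_forall_pow_mul_lt {r s : ℕ} (hrs : r < s) {h k : ℝ → ℝ} (hh : Continuous h)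
    (hk : Continuous k) (h0 : 0 < h 0) :
    ∃ ε > 0, ∀ p : ℝ, 0 < p → p < ε → p ^ s * k p < p ^ r * h p := by
  have hlt : ∀ᶠ p in nhds (0 : ℝ), p ^ (s - r) * k p < h p := by
    refine ContinuousAt.eventually_lt (by fun_prop) hh.continuousAt ?_
    rwa [zero_pow (by omega), zero_mul]
  obtain ⟨ε, hε, hball⟩ := Metric.eventually_nhds_iff.1 hlt
  refine ⟨ε, hε, fun p hp hpε => ?_⟩
  have hp' := hball (y := p) (by rwa [Real.dist_0_eq_abs, abs_of_pos hp])
  rw [← pow_mul_pow_sub p hrs.le, mul_assoc]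
  exact mul_lt_mul_of_pos_left hp' (pow_pos hp r)

/-- If `r₀ < r₁` then for all sufficiently small `p > 0` one has `f p > g p`,
and symmetrically if `r₀ > r₁` then `f p < g p` for all sufficiently small
`p > 0`: the heuristic decision rule comparing the minimal malicious cut set
sizes agrees with the maximum-likelihood comparison of `f p` and `g p`. -/
theorem heuristic_rule_agrees_with_ml_for_small_p
    (n n₀ n₁ : ℕ) (hn₀ : n₀ ≤ n) (hn₁ : n₁ ≤ n)
    (a b : ℕ → ℕ) (r₀ r₁ : ℕ)
    (hr₀mem : r₀ ∈ Finset.Icc 1 n₀) (hr₀pos : 0 < a r₀)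
    (hr₀min : ∀ i ∈ Finset.Icc 1 n₀, i < r₀ → a i = 0)
    (hr₁mem : r₁ ∈ Finset.Icc 1 n₁) (hr₁pos : 0 < b r₁)
    (hr₁min : ∀ i ∈ Finset.Icc 1 n₁, i < r₁ → b i = 0)
    (f g : ℝ → ℝ)
    (hf : ∀ p, f p = (1 - p) ^ (n - n₀) *
      ∑ i ∈ Finset.Icc r₀ n₀, (a i : ℝ) * p ^ i * (1 - p) ^ (n₀ - i))
    (hg : ∀ p, g p = (1 - p) ^ (n - n₁) *
      ∑ i ∈ Finset.Icc r₁ n₁, (b i : ℝ) * p ^ i * (1 - p) ^ (n₁ - i)) :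
    (r₀ < r₁ → ∃ ε > 0, ∀ p : ℝ, 0 < p → p < ε → f p > g p) ∧
    (r₀ > r₁ → ∃ ε > 0, ∀ p : ℝ, 0 < p → p < ε → f p < g p) := by
  obtain ⟨h, hh, h0, hfac⟩ := exists_continuous_factor (n - n₀) n₀ r₀ (Finset.mem_Icc.1 hr₀mem).2 a
  obtain ⟨k, hk, k0, kfac⟩ := exists_continuous_factor (n - n₁) n₁ r₁ (Finset.mem_Icc.1 hr₁mem).2 b
  simp only [hf, hg, hfac, kfac, gt_iff_lt]
  exact ⟨fun hlt => exists_pos_forall_pow_mul_lt hlt hh hk (by rw [h0]; exact_mod_cast hr₀pos),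
    fun hlt => exists_pos_forall_pow_mul_lt hlt hk hh (by rw [k0]; exact_mod_cast hr₁pos)⟩
end
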